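/- Let M ⊆ A → A and M' ⊆ B → B be closed transformation monoids, let G ⊆ M and G' ⊆ M' be submonoids consisting of invertible elements of M and M' respectively, with G dense in M and G' dense in M'. If ξ: G → G' is a monoid isomorphism such that both ξ and ξ⁻¹ are continuous, then there exists a monoid isomorphism ξ̄: M → M' extending ξ which is a uniform homeomorphism. -/

import Mathlib

open Set Function

universe u

/-- The uniformity of pointwise convergence on `I → X` arising from the
discrete uniformity on `X`. -/
noncomputable def funUnif (I X : Type*) : UniformSpace (I → X) :=
  @Pi.uniformSpace I (fun _ => X) (fun _ => ⊥)

/-- The topology of pointwise convergence on `I → X` (over discrete `X`). -/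
noncomputable def funTop (I X : Type*) : TopologicalSpace (I → X) :=
  (funUnif I X).toTopologicalSpace

/-- Topological closure w.r.t. the topology of pointwise convergence. -/
def fClosure {I X : Type*} (S : Set (I → X)) : Set (I → X) :=
  @closure _ (funTop I X) S

/-- Closedness w.r.t. the topology of pointwise convergence. -/
def fIsClosed {I X : Type*} (S : Set (I → X)) : Prop :=
  @IsClosed _ (funTop I X) S

/-- Continuity on a set of functions w.r.t. pointwise convergence topologies. -/
def fContinuousOn {I X J Y : Type*} (ξ : (I → X) → (J → Y)) (S : Set (I → X)) : Prop :=
  @ContinuousOn _ _ (funTop I X) (funTop J Y) ξ S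

/-- Uniform continuity on a set of functions w.r.t. pointwise uniformities. -/
def fUniformContinuousOn {I X J Y : Type*} (ξ : (I → X) → (J → Y)) (S : Set (I → X)) : Prop :=
  @UniformContinuousOn _ _ (funUnif I X) (funUnif J Y) ξ S

/-- A transformation monoid on `A`: a set of self-maps containing the identity
and closed under composition. -/
def IsTransMonoid {A : Type*} (M : Set (A → A)) : Prop :=
  id ∈ M ∧ ∀ f ∈ M, ∀ g ∈ M, f ∘ g ∈ M

/-- The set of invertible elements of a transformation monoid `M`. -/
def invertibles {A : Type*} (M : Set (A → A)) : Set (A → A) :=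
  {g | g ∈ M ∧ ∃ f ∈ M, f ∘ g = id ∧ g ∘ f = id}

/-- A monoid homomorphism from `M` to `M'`, given as a (total) map on functions. -/
def MonHomOn {A B : Type*} (M : Set (A → A)) (M' : Set (B → B))
    (ξ : (A → A) → (B → B)) : Prop :=
  Set.MapsTo ξ M M' ∧ ξ id = id ∧ ∀ f ∈ M, ∀ g ∈ M, ξ (f ∘ g) = ξ f ∘ ξ g

/-- A monoid isomorphism between `M` and `M'`, given by a pair of mutually
inverse monoid homomorphisms. -/
def MonIsoOn {A B : Type*} (M : Set (A → A)) (M' : Set (B → B))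
    (ξ : (A → A) → (B → B)) (ξ' : (B → B) → (A → A)) : Prop :=
  MonHomOn M M' ξ ∧ MonHomOn M' M ξ' ∧
    (∀ f ∈ M, ξ' (ξ f) = f) ∧ (∀ h ∈ M', ξ (ξ' h) = h)

theorem hasBasis_uniformity_funUnif (I X : Type*) :
    (@uniformity _ (funUnif I X)).HasBasis (fun _ : Finset I => True)
      (fun K => {p : (I → X) × (I → X) | ∀ i ∈ K, p.1 i = p.2 i}) := by
  have h : @uniformity _ (funUnif I X) =
      ⨅ i, Filter.principal {p : (I → X) × (I → X) | p.1 i = p.2 i} := by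
    let _ : UniformSpace X := ⊥
    exact (Pi.uniformity _).trans (iInf_congr fun i => Filter.comap_principal)
  rw [h]
  refine (Filter.hasBasis_iInf_principal_finite _).to_hasBasis
    (fun S hS => ⟨hS.toFinset, trivial, fun p hp => ?_⟩)
    (fun K _ => ⟨K, K.finite_toSet, fun p hp => ?_⟩)
  · exact mem_iInter₂.2 fun i hi => hp i (hS.mem_toFinset.2 hi)
  · exact fun i hi => mem_iInter₂.1 hp i hi

theorem hasBasis_nhds_funTop {I X : Type*} (f : I → X) :
    (@nhds _ (funTop I X) f).HasBasis (fun _ : Finset I => True)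
      (fun K => {g | ∀ i ∈ K, f i = g i}) :=
  let _ := funUnif I X
  nhds_basis_uniformity' (hasBasis_uniformity_funUnif I X)

theorem mem_fClosure_iff {I X : Type*} {S : Set (I → X)} {f : I → X} :
    f ∈ fClosure S ↔ ∀ K : Finset I, ∃ g ∈ S, ∀ i ∈ K, f i = g i := by
  let _ := funTop I X
  simpa [fClosure] using mem_closure_iff_nhds_basis (t := S) (hasBasis_nhds_funTop f)

theorem fIsClosed.mem {I X : Type*} {S : Set (I → X)} (hS : fIsClosed S) {f : I → X}
    (hf : ∀ K : Finset I, ∃ g ∈ S, ∀ i ∈ K, f i = g i) : f ∈ S := by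
  let _ := funTop I X
  have h : f ∈ closure S := mem_fClosure_iff.2 hf
  rwa [IsClosed.closure_eq hS] at h

/-- `D b` is a finite set on which the argument of `ξ` determines the value of `ξ` at `b`. -/
def IsModulusOn {A B : Type*} (G : Set (A → A)) (ξ : (A → A) → (B → B))
    (D : B → Finset A) : Prop :=
  ∀ b, ∀ f ∈ G, ∀ g ∈ G, (∀ a ∈ D b, f a = g a) → ξ f b = ξ g b

theorem IsModulusOn.fUniformContinuousOn {A B : Type*} {G : Set (A → A)}
    {ξ : (A → A) → (B → B)} {D : B → Finset A} (hD : IsModulusOn G ξ D) :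
    fUniformContinuousOn ξ G := by
  classical
  let _ := funUnif A A
  let _ := funUnif B B
  refine (((hasBasis_uniformity_funUnif A A).inf_principal _).tendsto_iff
    (hasBasis_uniformity_funUnif B B)).2 fun K _ => ⟨K.biUnion D, trivial, ?_⟩
  rintro ⟨f, g⟩ ⟨h, hf, hg⟩ b hb
  exact hD b f hf g hg fun a ha => h a (Finset.mem_biUnion.2 ⟨b, hb, ha⟩)

/-- The elements of `G` need not have inverses in `G`: an inverse in `M` is approximated by an
element of `G`. -/
theorem MonHomOn.exists_isModulusOn {A B : Type*} {M G : Set (A → A)} {M' G' : Set (B → B)}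
    (hG : IsTransMonoid G) (hGinv : G ⊆ invertibles M) (hG'inv : G' ⊆ invertibles M')
    (hdense : M ⊆ fClosure G) {ξ : (A → A) → (B → B)} (hξ : MonHomOn G G' ξ)
    (hcont : fContinuousOn ξ G) : ∃ D, IsModulusOn G ξ D := by
  classical
  have hid (b : B) : ∃ K : Finset A, ∀ g ∈ G, (∀ a ∈ K, g a = a) → ξ g b = b := by
    let _ := funTop A A
    let _ := funTop B B
    obtain ⟨K, -, hK⟩ := (((hasBasis_nhds_funTop (id : A → A)).inf_principal G).tendsto_iff
      (hasBasis_nhds_funTop (ξ id))).1 (hcont id hG.1) {b} trivial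
    refine ⟨K, fun g hg h => ?_⟩
    have := hK g ⟨fun a ha => (h a ha).symm, hg⟩ b (Finset.mem_singleton_self b)
    simpa [hξ.2.1] using this.symm
  choose D hD using hid
  refine ⟨D, fun b f hf g hg hfg => ?_⟩
  obtain ⟨-, k, hk, hkf, -⟩ := hGinv hf
  obtain ⟨h, hh, hhk⟩ := mem_fClosure_iff.1 (hdense hk) ((D b).image f)
  have hhf (a : A) (ha : a ∈ D b) : h (f a) = a := by
    rw [← hhk _ (Finset.mem_image_of_mem f ha)]
    exact congrFun hkf a
  obtain ⟨-, l, -, hl, -⟩ := hG'inv (hξ.1 hh)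
  have h₁ : ξ h (ξ f b) = b := by
    simpa [hξ.2.2 h hh f hf] using hD b _ (hG.2 h hh f hf) hhf
  have h₂ : ξ h (ξ g b) = b := by
    simpa [hξ.2.2 h hh g hg] using
      hD b _ (hG.2 h hh g hg) fun a ha => by simpa [← hfg a ha] using hhf a ha
  exact LeftInverse.injective (g := l) (f := ξ h) (congrFun hl) (h₁.trans h₂.symm)

/-- `ξbar` is the extension of `ξ` from `G` to `M` determined by the modulus `D`. -/
def IsExtensionOn {A B : Type*} (G M : Set (A → A)) (ξ ξbar : (A → A) → (B → B))
    (D : B → Finset A) : Prop :=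
  ∀ m ∈ M, ∀ b, ∀ g ∈ G, (∀ a ∈ D b, m a = g a) → ξbar m b = ξ g b

theorem IsModulusOn.exists_isExtensionOn {A B : Type*} {G M : Set (A → A)}
    {ξ : (A → A) → (B → B)} {D : B → Finset A} (hD : IsModulusOn G ξ D)
    (hdense : M ⊆ fClosure G) : ∃ ξbar, IsExtensionOn G M ξ ξbar D := by
  have key (m : A → A) (b : B) :
      ∃ c, m ∈ M → ∀ g ∈ G, (∀ a ∈ D b, m a = g a) → c = ξ g b := by
    by_cases hm : m ∈ M
    · obtain ⟨g, hg, hmg⟩ := mem_fClosure_iff.1 (hdense hm) (D b)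
      exact ⟨ξ g b, fun _ h hh hmh =>
        hD b g hg h hh fun a ha => (hmg a ha).symm.trans (hmh a ha)⟩
    · exact ⟨b, fun h => absurd h hm⟩
  choose ξbar hξbar using key
  exact ⟨ξbar, fun m hm b => hξbar m b hm⟩

namespace IsExtensionOn

variable {A B : Type*} {G M : Set (A → A)} {G' M' : Set (B → B)}
  {ξ ξbar : (A → A) → (B → B)} {D : B → Finset A}

theorem eq_of_mem (h : IsExtensionOn G M ξ ξbar D) (hGM : G ⊆ M) {g : A → A} (hg : g ∈ G) :
    ξbar g = ξ g :=
  funext fun b => h g (hGM hg) b g hg fun _ _ => rfl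

theorem isModulusOn (h : IsExtensionOn G M ξ ξbar D) (hdense : M ⊆ fClosure G) :
    IsModulusOn M ξbar D := by
  intro b m hm n hn hmn
  obtain ⟨g, hg, hmg⟩ := mem_fClosure_iff.1 (hdense hm) (D b)
  rw [h m hm b g hg hmg, h n hn b g hg fun a ha => (hmn a ha).symm.trans (hmg a ha)]

theorem monHomOn (h : IsExtensionOn G M ξ ξbar D) (hG : IsTransMonoid G)
    (hM : IsTransMonoid M) (hGM : G ⊆ M) (hG'M' : G' ⊆ M') (hdense : M ⊆ fClosure G)
    (hM'closed : fIsClosed M') (hξ : MonHomOn G G' ξ) : MonHomOn M M' ξbar := by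
  classical
  refine ⟨fun m hm => hM'closed.mem fun K => ?_, (h.eq_of_mem hGM hG.1).trans hξ.2.1,
    fun m hm n hn => funext fun b => ?_⟩
  · obtain ⟨g, hg, hmg⟩ := mem_fClosure_iff.1 (hdense hm) (K.biUnion D)
    exact ⟨ξ g, hG'M' (hξ.1 hg), fun b hb =>
      h m hm b g hg fun a ha => hmg a (Finset.mem_biUnion.2 ⟨b, hb, ha⟩)⟩
  · obtain ⟨k, hk, hnk⟩ := mem_fClosure_iff.1 (hdense hn) (D b)
    obtain ⟨g, hg, hmg⟩ := mem_fClosure_iff.1 (hdense hm) (D (ξ k b) ∪ (D b).image n)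
    rw [h _ (hM.2 m hm n hn) b (g ∘ k) (hG.2 g hg k hk), hξ.2.2 g hg k hk, comp_apply,
      comp_apply, h n hn b k hk hnk,
      h m hm _ g hg fun a ha => hmg a (Finset.mem_union_left _ ha)]
    intro a ha
    rw [comp_apply, comp_apply, ← hnk a ha]
    exact hmg _ (Finset.mem_union_right _ (Finset.mem_image_of_mem n ha))

theorem leftInverse {ξ' ξbar' : (B → B) → (A → A)} {D' : A → Finset B}
    (h : IsExtensionOn G M ξ ξbar D) (h' : IsExtensionOn G' M' ξ' ξbar' D')
    (hdense : M ⊆ fClosure G) (hmaps : MapsTo ξbar M M') (hξ : MapsTo ξ G G')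
    (hinv : ∀ g ∈ G, ξ' (ξ g) = g) : ∀ m ∈ M, ξbar' (ξbar m) = m := by
  classical
  intro m hm
  funext a
  obtain ⟨g, hg, hmg⟩ := mem_fClosure_iff.1 (hdense hm) (insert a ((D' a).biUnion D))
  rw [h' _ (hmaps hm) a (ξ g) (hξ hg), hinv g hg, hmg a (Finset.mem_insert_self _ _)]
  exact fun b hb => h m hm b g hg fun c hc =>
    hmg c (Finset.mem_insert_of_mem (Finset.mem_biUnion.2 ⟨b, hb, hc⟩))

end IsExtensionOn

/-- A bicontinuous monoid isomorphism between dense groups of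
invertibles of closed transformation monoids extends to a monoid isomorphism
between the monoids which is a uniform homeomorphism. -/
theorem exists_extension_iso_uniform_homeomorphism
    {A B : Type*} (M : Set (A → A)) (M' : Set (B → B))
    (G : Set (A → A)) (G' : Set (B → B))
    (hM : IsTransMonoid M) (hM' : IsTransMonoid M')
    (hMclosed : fIsClosed M) (hM'closed : fIsClosed M')
    (hG : IsTransMonoid G) (hG' : IsTransMonoid G')
    (hGinv : G ⊆ invertibles M) (hG'inv : G' ⊆ invertibles M')
    (hdense : M ⊆ fClosure G) (hdense' : M' ⊆ fClosure G')
    (ξ : (A → A) → (B → B)) (ξ' : (B → B) → (A → A))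
    (hiso : MonIsoOn G G' ξ ξ')
    (hcont : fContinuousOn ξ G) (hcont' : fContinuousOn ξ' G') :
    ∃ (ξbar : (A → A) → (B → B)) (ξbar' : (B → B) → (A → A)),
      MonIsoOn M M' ξbar ξbar' ∧ (∀ g ∈ G, ξbar g = ξ g) ∧
      fUniformContinuousOn ξbar M ∧ fUniformContinuousOn ξbar' M' := by
  obtain ⟨hξ, hξ', hl, hr⟩ := hiso
  have hGM : G ⊆ M := fun g hg => (hGinv hg).1
  have hG'M' : G' ⊆ M' := fun g hg => (hG'inv hg).1
  obtain ⟨D, hD⟩ := hξ.exists_isModulusOn hG hGinv hG'inv hdense hcont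
  obtain ⟨D', hD'⟩ := hξ'.exists_isModulusOn hG' hG'inv hGinv hdense' hcont'
  obtain ⟨ξbar, h⟩ := hD.exists_isExtensionOn hdense
  obtain ⟨ξbar', h'⟩ := hD'.exists_isExtensionOn hdense'
  have hhom := h.monHomOn hG hM hGM hG'M' hdense hM'closed hξ
  have hhom' := h'.monHomOn hG' hM' hG'M' hGM hdense' hMclosed hξ'
  exact ⟨ξbar, ξbar',
    ⟨hhom, hhom', h.leftInverse h' hdense hhom.1 hξ.1 hl,
      h'.leftInverse h hdense' hhom'.1 hξ'.1 hr⟩,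
    fun g hg => h.eq_of_mem hGM hg, (h.isModulusOn hdense).fUniformContinuousOn,
    (h'.isModulusOn hdense').fUniformContinuousOn⟩
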